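/- Let F be a differential field and M ∈ F^{n×n} nonderogatory with M M' = M' M. Then M^{(i)} M^{(j)} = M^{(j)} M^{(i)} for all nonnegative integers i, j. -/

import Mathlib

def IsDeriv {F : Type*} [Field F] (d : F → F) : Prop :=
  (∀ a b, d (a + b) = d a + d b) ∧ (∀ a b, d (a * b) = d a * b + a * d b)

open Polynomial in
theorem Module.End.exists_forall_aeval_apply_eq_zero {K V : Type*} [Field K] [AddCommGroup V]
    [Module K V] [FiniteDimensional K V] (f : Module.End K V) :
    ∃ v : V, ∀ p : K[X], aeval f p v = 0 → aeval f p = 0 := by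
  obtain ⟨x, hx⟩ := Module.exists_ker_toSpanSingleton_eq_annihilator K[X] (Module.AEval' f)
  obtain ⟨v, rfl⟩ := (Module.AEval'.of f).surjective x
  refine ⟨v, fun p hp ↦ ?_⟩
  rw [Module.AEval.annihilator_eq_ker_aeval] at hx
  rw [← RingHom.mem_ker, ← hx, LinearMap.mem_ker, LinearMap.toSpanSingleton_apply]
  exact hp

open Polynomial in
/-- A nonderogatory endomorphism of a finite-dimensional space has a cyclic vector. -/
theorem Module.End.exists_cyclic_vector {K V : Type*} [Field K] [AddCommGroup V]
    [Module K V] [FiniteDimensional K V] (f : Module.End K V)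
    (hf : (minpoly K f).natDegree = Module.finrank K V) :
    ∃ v : V, ∀ w : V, ∃ p : K[X], aeval f p v = w := by
  obtain ⟨v, hv⟩ := f.exists_forall_aeval_apply_eq_zero
  refine ⟨v, ?_⟩
  let φ : degreeLT K (Module.finrank K V) →ₗ[K] V :=
    LinearMap.applyₗ v ∘ₗ (aeval f).toLinearMap ∘ₗ (degreeLT K (Module.finrank K V)).subtype
  have hφ : Function.Injective φ := by
    rw [← LinearMap.ker_eq_bot, LinearMap.ker_eq_bot']
    rintro ⟨p, hp⟩ h
    refine Subtype.ext (eq_zero_of_dvd_of_degree_lt (minpoly.dvd K f (hv p h)) ?_)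
    rwa [degree_eq_natDegree (minpoly.ne_zero_of_finite K f), hf, ← mem_degreeLT]
  have e := degreeLTEquiv K (Module.finrank K V)
  have : FiniteDimensional K (degreeLT K (Module.finrank K V)) := e.symm.finiteDimensional
  have hs : Function.Surjective φ :=
    (LinearMap.injective_iff_surjective_of_finrank_eq_finrank (by simp [e.finrank_eq])).mp hφ
  intro w
  obtain ⟨p, hp⟩ := hs w
  exact ⟨p, hp⟩

open Polynomial in
/-- The commutant of a nonderogatory endomorphism consists of polynomials in it. -/
theorem Module.End.exists_aeval_eq_of_commute {K V : Type*} [Field K] [AddCommGroup V]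
    [Module K V] [FiniteDimensional K V] {f g : Module.End K V}
    (hf : (minpoly K f).natDegree = Module.finrank K V) (h : Commute f g) :
    ∃ p : K[X], aeval f p = g := by
  obtain ⟨v, hv⟩ := f.exists_cyclic_vector hf
  obtain ⟨p, hp⟩ := hv (g v)
  refine ⟨p, LinearMap.ext fun w ↦ ?_⟩
  obtain ⟨q, rfl⟩ := hv w
  have hq : aeval f q * g = g * aeval f q :=
    Algebra.commute_of_mem_adjoin_singleton_of_commute (aeval_mem_adjoin_singleton K f) h.symm |>.symm
  calc aeval f p (aeval f q v) = aeval f q (aeval f p v) := by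
        rw [← Module.End.mul_apply, ← Module.End.mul_apply, ← map_mul, ← map_mul, mul_comm]
    _ = g (aeval f q v) := by
        rw [hp, ← Module.End.mul_apply, ← Module.End.mul_apply, hq]

theorem Matrix.mem_adjoin_of_commute {n K : Type*} [Fintype n] [DecidableEq n] [Field K]
    {M N : Matrix n n K} (hM : minpoly K M = M.charpoly) (h : Commute M N) :
    N ∈ Algebra.adjoin K {M} := by
  have hf : (minpoly K (Matrix.toLinAlgEquiv' M)).natDegree = Module.finrank K (n → K) := by
    rw [minpoly.algEquiv_eq, hM, Matrix.charpoly_natDegree_eq_dim, Module.finrank_fintype_fun_eq_card]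
  obtain ⟨p, hp⟩ := Module.End.exists_aeval_eq_of_commute hf (h.map Matrix.toLinAlgEquiv')
  rw [Polynomial.aeval_algEquiv] at hp
  rw [← Matrix.toLinAlgEquiv'.injective hp]
  exact Polynomial.aeval_mem_adjoin_singleton K M

namespace IsDeriv

variable {F : Type*} [Field F] {d : F → F}

theorem map_zero (hd : IsDeriv d) : d 0 = 0 := by
  simpa using hd.1 0 0

theorem map_sum (hd : IsDeriv d) {ι : Type*} (s : Finset ι) (f : ι → F) :
    d (∑ i ∈ s, f i) = ∑ i ∈ s, d (f i) :=
  _root_.map_sum (⟨⟨d, hd.map_zero⟩, hd.1⟩ : F →+ F) f s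

theorem matrix_map_mul (hd : IsDeriv d) {n : Type*} [Fintype n] (A B : Matrix n n F) :
    (A * B).map d = A.map d * B + A * B.map d := by
  ext i j
  simp [Matrix.mul_apply, hd.map_sum, hd.2, Finset.sum_add_distrib]

theorem map_mem_adjoin (hd : IsDeriv d) {n : Type*} [Fintype n] [DecidableEq n]
    {M : Matrix n n F} (hM : M.map d ∈ Algebra.adjoin F {M}) {A : Matrix n n F}
    (hA : A ∈ Algebra.adjoin F {M}) : A.map d ∈ Algebra.adjoin F {M} := by
  induction hA using Algebra.adjoin_induction with
  | mem x hx => rwa [Set.mem_singleton_iff.mp hx]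
  | algebraMap r =>
    rw [Matrix.algebraMap_eq_diagonal, Matrix.diagonal_map hd.map_zero]
    exact Subalgebra.algebraMap_mem _ (d r)
  | add x y _ _ hx hy =>
    rw [Matrix.map_add _ hd.1]
    exact add_mem hx hy
  | mul x y hx' hy' hx hy =>
    rw [hd.matrix_map_mul]
    exact add_mem (mul_mem hx hy') (mul_mem hx' hy)

end IsDeriv

/-- For a nonderogatory matrix commuting with its derivative, all entrywise
derivatives pairwise commute. -/
theorem nonderogatory_derivatives_commute {F : Type*} [Field F] (d : F → F) (hd : IsDeriv d)
    {n : ℕ} (M : Matrix (Fin n) (Fin n) F)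
    (hnd : minpoly F M = M.charpoly)
    (hcomm : M * M.map d = M.map d * M) :
    ∀ i j : ℕ, M.map (d^[i]) * M.map (d^[j]) = M.map (d^[j]) * M.map (d^[i]) := by
  have hmem (i : ℕ) : M.map (d^[i]) ∈ Algebra.adjoin F {M} := by
    induction i with
    | zero => simp
    | succ i ih =>
      rw [Function.iterate_succ', ← Matrix.map_map]
      exact hd.map_mem_adjoin (Matrix.mem_adjoin_of_commute hnd hcomm) ih
  intro i j
  exact Algebra.commute_of_mem_adjoin_singleton_of_commute (hmem j)
    (Algebra.commute_of_mem_adjoin_self (hmem i)).symm
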